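/- The random-sampling update of the mass fraction is conservative in the mean: with uniform velocity u^n_{j+1/2} = u⁰ > 0 for all j and 0 < λu⁰ ≤ 1/2, if a is a random variable uniformly distributed on (0,1), then the sampled value satisfies Y^{n+1}_j = Y^{n+1−}_{j−1} when a ≤ λu⁰ and Y^{n+1}_j = Y^{n+1−}_j when a > λu⁰, so that E[Y^{n+1}_j] = λu⁰ Y^{n+1−}_{j−1} + (1 − λu⁰) Y^{n+1−}_j for every j, which coincides with the conservative upwind average of Y on the shifted grid. -/

import Mathlib

open MeasureTheory

/-- The random-sampling projection of the mass fraction: with Eulerian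
interfaces x_{j+1/2} = jΔx, moved interfaces x*_{j+1/2} = jΔx + u⁰Δt and
sampling point x*_j = x_{j−1/2} + aΔx = (j−1)Δx + aΔx, set
Y^{n+1}_j = Y^{n+1−}_{j−1} if x*_j ≤ x*_{j−1/2},
Y^{n+1}_j = Y^{n+1−}_{j+1} if x*_j ≥ x*_{j+1/2}, and
Y^{n+1}_j = Y^{n+1−}_j otherwise. -/
noncomputable def sampleY (Δx Δt u0 a : ℝ) (Y : ℤ → ℝ) (j : ℤ) : ℝ :=
  if ((j : ℝ) - 1) * Δx + a * Δx ≤ ((j : ℝ) - 1) * Δx + u0 * Δt then Y (j - 1)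
  else if (j : ℝ) * Δx + u0 * Δt ≤ ((j : ℝ) - 1) * Δx + a * Δx then Y (j + 1)
  else Y j

theorem sampleY_of_le {Δx Δt u0 a : ℝ} (hΔx : 0 < Δx) (ha : a ≤ Δt / Δx * u0)
    (Y : ℤ → ℝ) (j : ℤ) : sampleY Δx Δt u0 a Y j = Y (j - 1) := by
  have h : a * Δx ≤ u0 * Δt := by
    rw [← le_div_iff₀ hΔx]
    exact ha.trans_eq (by ring)
  rw [sampleY, if_pos (by linarith)]

theorem sampleY_of_lt {Δx Δt u0 a : ℝ} (hΔx : 0 < Δx) (hu : 0 < Δt / Δx * u0)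
    (ha : Δt / Δx * u0 < a) (ha1 : a < 1) (Y : ℤ → ℝ) (j : ℤ) :
    sampleY Δx Δt u0 a Y j = Y j := by
  have h : u0 * Δt < a * Δx := by
    rw [← div_lt_iff₀ hΔx]
    exact lt_of_eq_of_lt (by ring) ha
  have h0 : 0 < u0 * Δt := by
    have := mul_pos hu hΔx
    rwa [mul_right_comm, div_mul_cancel₀ _ hΔx.ne', mul_comm] at this
  rw [sampleY, if_neg (by linarith), if_neg (by nlinarith)]

/-- the random-sampling update of the mass fraction is
conservative in the mean: with uniform velocity u⁰ > 0 and 0 < λu⁰ ≤ 1/2, if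
a is uniformly distributed on (0,1) then Y^{n+1}_j = Y^{n+1−}_{j−1} when
a ≤ λu⁰ and Y^{n+1}_j = Y^{n+1−}_j when a > λu⁰, and
E[Y^{n+1}_j] = λu⁰ Y^{n+1−}_{j−1} + (1 − λu⁰) Y^{n+1−}_j for every j, which is
the conservative upwind average of Y on the shifted grid. -/
theorem sampling_conservative_in_the_mean
    (Δx Δt lam u0 : ℝ)
    (hΔx : 0 < Δx) (hΔt : 0 < Δt) (hlam : lam = Δt / Δx)
    (hu0 : 0 < u0) (hcfl1 : 0 < lam * u0) (hcfl2 : lam * u0 ≤ 1 / 2)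
    (Y : ℤ → ℝ) :
    (∀ j : ℤ, ∀ a ∈ Set.Ioo (0 : ℝ) 1,
      (a ≤ lam * u0 → sampleY Δx Δt u0 a Y j = Y (j - 1)) ∧
      (lam * u0 < a → sampleY Δx Δt u0 a Y j = Y j)) ∧
    ∀ j : ℤ,
      (∫ a in Set.Ioo (0 : ℝ) 1, sampleY Δx Δt u0 a Y j) =
        lam * u0 * Y (j - 1) + (1 - lam * u0) * Y j := by
  subst hlam
  refine ⟨fun j a ha => ⟨fun h => sampleY_of_le hΔx h Y j,
    fun h => sampleY_of_lt hΔx hcfl1 h ha.2 Y j⟩, fun j => ?_⟩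
  generalize hc : Δt / Δx * u0 = c at hcfl1 hcfl2 ⊢
  have hl : Set.EqOn (fun a => sampleY Δx Δt u0 a Y j) (fun _ => Y (j - 1)) (Set.Ioc 0 c) :=
    fun a ha => sampleY_of_le hΔx (hc ▸ ha.2) Y j
  have hr : Set.EqOn (fun a => sampleY Δx Δt u0 a Y j) (fun _ => Y j) (Set.Ioo c 1) :=
    fun a ha => sampleY_of_lt hΔx (hc ▸ hcfl1) (hc ▸ ha.1) ha.2 Y j
  have hd : Disjoint (Set.Ioc 0 c) (Set.Ioo c 1) :=
    Set.disjoint_left.2 fun _ h h' => h'.1.not_ge h.2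
  rw [← Set.Ioc_union_Ioo_eq_Ioo hcfl1.le (by linarith),
    setIntegral_union hd measurableSet_Ioo
      ((integrableOn_congr_fun hl measurableSet_Ioc).2 (integrableOn_const (by simp)))
      ((integrableOn_congr_fun hr measurableSet_Ioo).2 (integrableOn_const (by simp))),
    setIntegral_congr_fun measurableSet_Ioc hl, setIntegral_congr_fun measurableSet_Ioo hr,
    setIntegral_const, setIntegral_const, Real.volume_real_Ioc_of_le hcfl1.le,
    Real.volume_real_Ioo_of_le (by linarith), sub_zero, smul_eq_mul, smul_eq_mul]
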